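/- Let $w_-<w_m$ with $\delta_R=w_m-w_-$, let $w_0$ be the tanh profile, and let $w(t,x)=w_0(\Phi_t^{-1}(x))$ be the Burgers solution. Then for every $t\ge 0$ and every $x\ge w_m t$, one has $0\le w_m-w(t,x)\le\delta_R\,e^{-2(x-w_m t)}$ and $0<\partial_x w(t,x)\le 2\,\delta_R\,e^{-2(x-w_m t)}$. -/

import Mathlib

/-- The tanh profile `w₀(x) = (w_m + w_-)/2 + (w_m - w_-)/2 * tanh x`. -/
noncomputable def tanhProfile (wminus wm : ℝ) (x : ℝ) : ℝ :=
  (wm + wminus) / 2 + (wm - wminus) / 2 * Real.tanh x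

/-- The characteristic map `Φ_t(y) = y + t w₀(y)`. -/
noncomputable def charMap (wminus wm t : ℝ) (y : ℝ) : ℝ :=
  y + t * tanhProfile wminus wm y

/-- The Burgers solution `w(t,x) = w₀(Φ_t⁻¹(x))`. -/
noncomputable def burgersSol (wminus wm : ℝ) (t x : ℝ) : ℝ :=
  tanhProfile wminus wm (Function.invFun (charMap wminus wm t) x)

theorem Real.hasDerivAt_tanh (y : ℝ) : HasDerivAt Real.tanh (1 - Real.tanh y ^ 2) y := by
  have hc : Real.cosh y ≠ 0 := (Real.cosh_pos y).ne'
  have h := (Real.hasDerivAt_sinh y).div (Real.hasDerivAt_cosh y) hc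
  have heq : Real.tanh = Real.sinh / Real.cosh := funext Real.tanh_eq_sinh_div_cosh
  rw [Real.tanh_eq_sinh_div_cosh y, heq]
  refine h.congr_deriv ?_
  field_simp

theorem Real.one_sub_tanh_le (y : ℝ) : 1 - Real.tanh y ≤ 2 * Real.exp (-2 * y) := by
  have hp := Real.exp_pos y
  have hn := Real.exp_pos (-y)
  have hmul : Real.exp y * Real.exp (-2 * y) = Real.exp (-y) := by
    rw [← Real.exp_add]
    ring_nf
  have hz := Real.exp_pos (-2 * y)
  have heq : 1 - Real.tanh y = 2 * Real.exp (-y) / (Real.exp y + Real.exp (-y)) := by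
    rw [Real.tanh_eq]
    field_simp
    ring
  rw [heq, div_le_iff₀ (by positivity)]
  nlinarith [mul_pos hz hn]

theorem hasDerivAt_tanhProfile (wminus wm y : ℝ) :
    HasDerivAt (tanhProfile wminus wm) ((wm - wminus) / 2 * (1 - Real.tanh y ^ 2)) y :=
  ((Real.hasDerivAt_tanh y).const_mul _).const_add _

theorem hasDerivAt_charMap (wminus wm t y : ℝ) :
    HasDerivAt (charMap wminus wm t)
      (1 + t * ((wm - wminus) / 2 * (1 - Real.tanh y ^ 2))) y :=
  (hasDerivAt_id y).add ((hasDerivAt_tanhProfile wminus wm y).const_mul t)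

theorem one_sub_tanh_sq_pos (y : ℝ) : 0 < 1 - Real.tanh y ^ 2 := by
  nlinarith [Real.tanh_lt_one y, Real.neg_one_lt_tanh y]

theorem one_add_mul_deriv_tanhProfile_ge_one {wminus wm t : ℝ} (h : wminus < wm) (ht : 0 ≤ t)
    (y : ℝ) : 1 ≤ 1 + t * ((wm - wminus) / 2 * (1 - Real.tanh y ^ 2)) := by
  have h₁ := one_sub_tanh_sq_pos y
  have h₂ := sub_pos.2 h
  have : 0 ≤ t * ((wm - wminus) / 2 * (1 - Real.tanh y ^ 2)) := by positivity
  linarith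

theorem tanhProfile_le {wminus wm : ℝ} (h : wminus < wm) (y : ℝ) :
    tanhProfile wminus wm y ≤ wm := by
  unfold tanhProfile
  nlinarith [Real.tanh_lt_one y]

theorem le_tanhProfile {wminus wm : ℝ} (h : wminus < wm) (y : ℝ) :
    wminus ≤ tanhProfile wminus wm y := by
  unfold tanhProfile
  nlinarith [Real.neg_one_lt_tanh y]

theorem strictMono_charMap {wminus wm t : ℝ} (h : wminus < wm) (ht : 0 ≤ t) :
    StrictMono (charMap wminus wm t) :=
  strictMono_of_hasDerivAt_pos (hasDerivAt_charMap wminus wm t) fun y =>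
    one_pos.trans_le (one_add_mul_deriv_tanhProfile_ge_one h ht y)

theorem surjective_charMap {wminus wm t : ℝ} (h : wminus < wm) (ht : 0 ≤ t) :
    Function.Surjective (charMap wminus wm t) := by
  refine Continuous.surjective
    (continuous_iff_continuousAt.2 fun y => (hasDerivAt_charMap wminus wm t y).continuousAt) ?_ ?_
  · exact Filter.tendsto_atTop_mono
      (fun y => by
        have := mul_le_mul_of_nonneg_left (le_tanhProfile h y) ht
        simp only [charMap, id]
        linarith)
      (Filter.tendsto_atTop_add_const_right _ (t * wminus) Filter.tendsto_id)
  · exact Filter.tendsto_atBot_mono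
      (fun y => by
        have := mul_le_mul_of_nonneg_left (tanhProfile_le h y) ht
        simp only [charMap, id]
        linarith)
      (Filter.tendsto_atBot_add_const_right _ (t * wm) Filter.tendsto_id)

theorem continuous_invFun_charMap {wminus wm t : ℝ} (h : wminus < wm) (ht : 0 ≤ t) :
    Continuous (Function.invFun (charMap wminus wm t)) := by
  have hr := Function.rightInverse_invFun (surjective_charMap h ht)
  have hl := Function.leftInverse_invFun (strictMono_charMap h ht).injective
  refine Monotone.continuous_of_surjective (fun a b hab => ?_) hl.surjective
  rw [← (strictMono_charMap h ht).le_iff_le, hr a, hr b]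
  exact hab

theorem hasDerivAt_burgersSol {wminus wm t : ℝ} (h : wminus < wm) (ht : 0 ≤ t) (x : ℝ) :
    HasDerivAt (burgersSol wminus wm t)
      ((wm - wminus) / 2 * (1 - Real.tanh (Function.invFun (charMap wminus wm t) x) ^ 2) /
        (1 + t * ((wm - wminus) / 2 *
          (1 - Real.tanh (Function.invFun (charMap wminus wm t) x) ^ 2)))) x := by
  have hinv := HasDerivAt.of_local_left_inverse (continuous_invFun_charMap h ht).continuousAt
    (hasDerivAt_charMap wminus wm t (Function.invFun (charMap wminus wm t) x))
    (one_pos.trans_le (one_add_mul_deriv_tanhProfile_ge_one h ht _)).ne'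
    (.of_forall (Function.rightInverse_invFun (surjective_charMap h ht)))
  exact (hasDerivAt_tanhProfile wminus wm _).comp x hinv

/-- For every `t ≥ 0` and every `x ≥ w_m t`:
`0 ≤ w_m - w(t,x) ≤ δ_R e^{-2(x - w_m t)}` and `0 < ∂ₓ w(t,x) ≤ 2 δ_R e^{-2(x - w_m t)}`. -/
theorem stmt_8 (wminus wm : ℝ) (h : wminus < wm) (t x : ℝ) (ht : 0 ≤ t) (hx : wm * t ≤ x) :
    0 ≤ wm - burgersSol wminus wm t x ∧
      wm - burgersSol wminus wm t x ≤ (wm - wminus) * Real.exp (-2 * (x - wm * t)) ∧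
      0 < deriv (fun ξ => burgersSol wminus wm t ξ) x ∧
      deriv (fun ξ => burgersSol wminus wm t ξ) x ≤
        2 * (wm - wminus) * Real.exp (-2 * (x - wm * t)) := by
  rw [(hasDerivAt_burgersSol h ht x).deriv, burgersSol]
  have hxy := Function.rightInverse_invFun (surjective_charMap h ht) x
  set y := Function.invFun (charMap wminus wm t) x
  have hδ := sub_pos.2 h
  have hy : x - wm * t ≤ y := by
    have := mul_le_mul_of_nonneg_left (tanhProfile_le h y) ht
    unfold charMap at hxy
    linarith
  have htanh : 1 - Real.tanh y ≤ 2 * Real.exp (-2 * (x - wm * t)) :=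
    (Real.one_sub_tanh_le y).trans (by gcongr ?_ * Real.exp ?_; linarith)
  have hlt := Real.tanh_lt_one y
  have hpos := one_sub_tanh_sq_pos y
  have hden := one_add_mul_deriv_tanhProfile_ge_one h ht y
  refine ⟨sub_nonneg.2 (tanhProfile_le h y), ?_, ?_, ?_⟩
  · unfold tanhProfile
    nlinarith [mul_le_mul_of_nonneg_left htanh hδ.le]
  · exact div_pos (by positivity) (one_pos.trans_le hden)
  · refine (div_le_self (by positivity) hden).trans ?_
    have hsq : 1 - Real.tanh y ^ 2 ≤ 2 * (1 - Real.tanh y) := by nlinarith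
    nlinarith [mul_le_mul_of_nonneg_left (hsq.trans (mul_le_mul_of_nonneg_left htanh two_pos.le))
      hδ.le]
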